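/- arXiv:1302.6116 — 3 statements merged into one kernel-verified Lean document; each statement's English description precedes it below -/
import Mathlib

section
/- Let p, x, y be unit vectors in ℝ³ with x ≠ y and ⟨x,y⟩ > −1, let t ∈ (π/2, π), and suppose ⟨p,x⟩ ≤ cos t and ⟨p,y⟩ ≤ cos t. Set θ := arccos⟨x,y⟩ ∈ (0,π). Then for every s ∈ (0,1) the point z_s := (sin((1−s)θ)·x + sin(sθ)·y)/sin θ on the minimizing great-circle arc from x to y satisfies ⟨p, z_s⟩ < cos t. Consequently, for every t ∈ (π/2,π), the set S² \ B_t(p) is strictly convex: the interior of any minimizing geodesic between two points of ∂B_t(p) lies in S² \ closure(B_t(p)). -/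
open Real
open scoped InnerProductSpace

/-- Strict subadditivity of the sine, for positive angles with sum less than `π`. -/
theorem Real.sin_add_lt_sin_add_sin {a b : ℝ} (ha : 0 < a) (hb : 0 < b) (hab : a + b < π) :
    sin (a + b) < sin a + sin b := by
  have hsa : 0 < sin a := sin_pos_of_pos_of_lt_pi ha (by linarith)
  have hsb : 0 < sin b := sin_pos_of_pos_of_lt_pi hb (by linarith)
  have hca : cos a < 1 := by
    simpa using cos_lt_cos_of_nonneg_of_le_pi le_rfl (by linarith) ha
  have hcb : cos b < 1 := by
    simpa using cos_lt_cos_of_nonneg_of_le_pi le_rfl (by linarith) hb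
  rw [sin_add]
  nlinarith [mul_pos hsa (sub_pos.2 hcb), mul_pos hsb (sub_pos.2 hca)]

/-- Strict convexity of `S² \ B_t(p)` for `t ∈ (π/2, π)` on the unit sphere:
along the minimizing great-circle arc from `x` to `y`, every interior point has
inner product with `p` strictly less than `cos t`. -/
theorem sphere_complement_ball_strictly_convex
    (p x y : EuclideanSpace ℝ (Fin 3))
    (hp : ‖p‖ = 1) (hx : ‖x‖ = 1) (hy : ‖y‖ = 1)
    (hxy : x ≠ y) (hna : ⟪x, y⟫_ℝ > -1)
    (t : ℝ) (ht : t ∈ Set.Ioo (π / 2) π)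
    (hpx : ⟪p, x⟫_ℝ ≤ Real.cos t) (hpy : ⟪p, y⟫_ℝ ≤ Real.cos t) :
    ∀ s ∈ Set.Ioo (0 : ℝ) 1,
      ⟪p, (Real.sin (Real.arccos ⟪x, y⟫_ℝ))⁻¹ •
        (Real.sin ((1 - s) * Real.arccos ⟪x, y⟫_ℝ) • x +
          Real.sin (s * Real.arccos ⟪x, y⟫_ℝ) • y)⟫_ℝ < Real.cos t := by
  rintro s ⟨hs0, hs1⟩
  have hθ0 : 0 < arccos ⟪x, y⟫_ℝ :=
    arccos_pos.2 ((inner_lt_one_iff_real_of_norm_eq_one hx hy).2 hxy)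
  have hθπ : arccos ⟪x, y⟫_ℝ < π :=
    lt_of_le_of_ne (arccos_le_pi _) fun h => hna.not_ge (arccos_eq_pi.1 h)
  have hct : cos t < 0 :=
    cos_neg_of_pi_div_two_lt_of_lt ht.1 (by linarith [ht.2, pi_pos])
  set θ := arccos ⟪x, y⟫_ℝ
  have ha : 0 < (1 - s) * θ := mul_pos (sub_pos.2 hs1) hθ0
  have hb : 0 < s * θ := mul_pos hs0 hθ0
  have hab : (1 - s) * θ + s * θ = θ := by ring
  have hsin : 0 < sin θ := sin_pos_of_pos_of_lt_pi hθ0 hθπ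
  have hsa : 0 < sin ((1 - s) * θ) := sin_pos_of_pos_of_lt_pi ha (by linarith)
  have hsb : 0 < sin (s * θ) := sin_pos_of_pos_of_lt_pi hb (by linarith)
  have hlt := Real.sin_add_lt_sin_add_sin ha hb (by linarith)
  rw [hab] at hlt
  rw [inner_smul_right, inner_add_right, inner_smul_right, inner_smul_right,
    inv_mul_lt_iff₀ hsin]
  calc sin ((1 - s) * θ) * ⟪p, x⟫_ℝ + sin (s * θ) * ⟪p, y⟫_ℝ
      ≤ sin ((1 - s) * θ) * cos t + sin (s * θ) * cos t := by gcongr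
    _ = (sin ((1 - s) * θ) + sin (s * θ)) * cos t := by ring
    _ < sin θ * cos t := mul_lt_mul_of_neg_right hlt hct
end

section
/- Let f(t) := e^{−t²}·tanh t and G(t) := −f″(t)/f(t). Then G is non-increasing on (0, ∞). -/
theorem hasDerivAt_tanh_one_sub_sq (t : ℝ) :
    HasDerivAt Real.tanh (1 - Real.tanh t ^ 2) t := by
  have hc : Real.cosh t ≠ 0 := (Real.cosh_pos t).ne'
  have h := (Real.hasDerivAt_sinh t).fun_div (Real.hasDerivAt_cosh t) hc
  have he : Real.tanh = fun x => Real.sinh x / Real.cosh x :=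
    funext Real.tanh_eq_sinh_div_cosh
  rw [he]
  refine h.congr_deriv ?_
  field_simp

theorem hasDerivAt_exp_neg_sq_mul {g : ℝ → ℝ} {g' t : ℝ} (hg : HasDerivAt g g' t) :
    HasDerivAt (fun x => Real.exp (-x ^ 2) * g x) (Real.exp (-t ^ 2) * (g' - 2 * t * g t)) t := by
  have h := ((hasDerivAt_pow 2 t).fun_neg.exp).fun_mul hg
  refine h.congr_deriv ?_
  norm_num
  ring

theorem deriv_deriv_exp_neg_sq_mul_tanh (t : ℝ) :
    deriv (deriv fun x => Real.exp (-x ^ 2) * Real.tanh x) t =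
      Real.exp (-t ^ 2) * ((4 * t ^ 2 - 2) * Real.tanh t
        - (4 * t + 2 * Real.tanh t) * (1 - Real.tanh t ^ 2)) := by
  have h1 : (deriv fun x => Real.exp (-x ^ 2) * Real.tanh x) =
      fun x => Real.exp (-x ^ 2) * (1 - Real.tanh x ^ 2 - 2 * x * Real.tanh x) :=
    funext fun x => (hasDerivAt_exp_neg_sq_mul (hasDerivAt_tanh_one_sub_sq x)).deriv
  have ht := hasDerivAt_tanh_one_sub_sq t
  have h2 := ((ht.fun_pow 2).const_sub 1).fun_sub (((hasDerivAt_id' t).const_mul 2).fun_mul ht)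
  rw [h1, (hasDerivAt_exp_neg_sq_mul h2).deriv]
  norm_num
  ring

theorem convexOn_sinh_Ici_zero : ConvexOn ℝ (Set.Ici 0) Real.sinh := by
  refine MonotoneOn.convexOn_of_deriv (convex_Ici 0) Real.continuous_sinh.continuousOn
    Real.differentiable_sinh.differentiableOn ?_
  rw [interior_Ici, Real.deriv_sinh]
  intro a ha b hb hab
  rw [Real.cosh_le_cosh, abs_of_pos ha, abs_of_pos hb]
  exact hab

theorem antitoneOn_div_sinh : AntitoneOn (fun t : ℝ => t / Real.sinh t) (Set.Ioi 0) := by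
  intro a ha b hb hab
  have ha' : 0 < a := ha
  have hb' : 0 < b := hb
  have h := convexOn_sinh_Ici_zero.secant_mono (a := 0) Set.self_mem_Ici ha'.le hb'.le
    ha'.ne' hb'.ne' hab
  simp only [Real.sinh_zero, sub_zero] at h
  rw [div_le_div_iff₀ ha' hb'] at h
  change b / Real.sinh b ≤ a / Real.sinh a
  rw [div_le_div_iff₀ (Real.sinh_pos_iff.2 hb') (Real.sinh_pos_iff.2 ha')]
  linarith

/-- Example 1.2 of the paper: the radial curvature `G = −f″/f` of the surface
with warping function `f t = e^{−t²} tanh t` is non-increasing on `(0,∞)`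
(von Mangoldt property). -/
theorem atypical_von_Mangoldt
    (f G : ℝ → ℝ) (hf : ∀ t, f t = Real.exp (-t ^ 2) * Real.tanh t)
    (hG : ∀ t, G t = -(deriv (deriv f) t) / f t) :
    AntitoneOn G (Set.Ioi 0) := by
  obtain rfl : f = fun t => Real.exp (-t ^ 2) * Real.tanh t := funext hf
  have key : ∀ t : ℝ, 0 < t →
      G t = 2 - 4 * t ^ 2 + 4 * (2 * t / Real.sinh (2 * t)) + 2 / Real.cosh t ^ 2 := by
    intro t ht
    have hs : Real.sinh t ≠ 0 := (Real.sinh_pos_iff.2 ht).ne'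
    have hc : Real.cosh t ≠ 0 := (Real.cosh_pos t).ne'
    have hsq : 1 - (Real.sinh t / Real.cosh t) ^ 2 = 1 / Real.cosh t ^ 2 := by
      field_simp
      linarith [Real.cosh_sq t]
    rw [hG, deriv_deriv_exp_neg_sq_mul_tanh]
    beta_reduce
    rw [Real.tanh_eq_sinh_div_cosh, hsq, Real.sinh_two_mul]
    field_simp
    ring
  intro a ha b hb hab
  have ha' : 0 < a := ha
  have hb' : 0 < b := hb
  rw [key a ha', key b hb']
  have h1 : 2 * b / Real.sinh (2 * b) ≤ 2 * a / Real.sinh (2 * a) :=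
    antitoneOn_div_sinh (Set.mem_Ioi.2 (by positivity)) (Set.mem_Ioi.2 (by positivity))
      (by linarith)
  have h2 : Real.cosh a ≤ Real.cosh b := by
    rwa [Real.cosh_le_cosh, abs_of_pos ha', abs_of_pos hb']
  have h3 : 2 / Real.cosh b ^ 2 ≤ 2 / Real.cosh a ^ 2 := by
    have := Real.cosh_pos a
    gcongr
  have h4 : a ^ 2 ≤ b ^ 2 := by gcongr
  linarith
end

section
/- Let q > 1 be a real number. Then lim_{h→0⁺} (((1−h)^q + h^q)^{1/q} − 1)/(h·2^{1/q}) = −2^{−1/q}. Equivalently, in ℝ² equipped with the ℓ^q norm, taking p = (0,0), x = (1,0) and the segment c(h) = (1−h, h), the cosine of the forward angle satisfies cos ∠→(p x y) = −lim_{h→0⁺} (‖c(h)‖_q − ‖c(0)‖_q)/‖c(h) − c(0)‖_q = 2^{−1/q}. -/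
/-- Along the segment from `(1, 0)` to `(0, 1)`, the `ℓ^q` norm has derivative `-1` at the
starting point. -/
theorem hasDerivAt_ellq_norm_segment {q : ℝ} (hq : 1 < q) :
    HasDerivAt (fun h : ℝ => ((1 - h) ^ q + h ^ q) ^ (1 / q)) (-1) 0 := by
  have hq0 : q ≠ 0 := by positivity
  have h₁ : HasDerivAt (fun h : ℝ => (1 - h) ^ q) (-q) 0 := by
    simpa using ((hasDerivAt_id (0 : ℝ)).const_sub 1).rpow_const (p := q) (Or.inr hq.le)
  have h₂ : HasDerivAt (fun h : ℝ => h ^ q) 0 0 := by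
    simpa [Real.zero_rpow (sub_ne_zero.2 hq.ne')] using
      Real.hasDerivAt_rpow_const (x := 0) (p := q) (Or.inr hq.le)
  have h₃ : HasDerivAt (fun h : ℝ => (1 - h) ^ q + h ^ q) (-q) 0 := by
    simpa using h₁.fun_add h₂
  convert h₃.rpow_const (p := 1 / q) (Or.inl (by simp [Real.zero_rpow hq0])) using 1
  simp [Real.zero_rpow hq0, hq0]

/-- Example 2.1 of the paper: in the `ℓ^q` plane with `p = (0,0)`, `x = (1,0)`,
`c(h) = (1−h, h)`, the difference quotient defining the cosine of the forward
angle at `x` satisfies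
`lim_{h→0⁺} (((1−h)^q + h^q)^{1/q} − 1)/(h·2^{1/q}) = −2^{−1/q}`. -/
theorem ellq_forward_angle_limit (q : ℝ) (hq : 1 < q) :
    Filter.Tendsto
      (fun h : ℝ => (((1 - h) ^ q + h ^ q) ^ (1 / q) - 1) / (h * (2 : ℝ) ^ (1 / q)))
      (nhdsWithin 0 (Set.Ioi 0)) (nhds (-(2 : ℝ) ^ (-(1 / q)))) := by
  have hq0 : q ≠ 0 := by positivity
  have hslope := (hasDerivAt_ellq_norm_segment hq).tendsto_slope_zero_right
  convert hslope.div_const ((2 : ℝ) ^ (1 / q)) using 1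
  · funext h
    simp [Real.zero_rpow hq0, div_eq_mul_inv]
    ring
  · rw [Real.rpow_neg zero_le_two, neg_div, one_div (2 ^ (1 / q))]
end
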